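/- Let f : 𝔻^m → ℂ be holomorphic with sup_{0<r<1} (∫_{𝕋^m} |f(rz)|^p dz)^{1/p} = M < ∞ for some 1 ≤ p < ∞. Then for every z ∈ 𝔻^m, |f(z)| ≤ M · Π_{n=1}^m (1 − |z_n|²)^{−1/p}. -/

import Mathlib

open MeasureTheory
open scoped BigOperators

namespace CG

lemma norm_e (ζ : UnitAddCircle) : ‖(fourier 1 ζ : ℂ)‖ = 1 := by
  rw [fourier_apply]
  exact Circle.norm_coe _

lemma integral_circle {E : Type*} [NormedAddCommGroup E] [NormedSpace ℝ E] (f : ℂ → E) :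
    ∫ ζ : UnitAddCircle, f (fourier 1 ζ) ∂AddCircle.haarAddCircle = Real.circleAverage f 0 1 := by
  rw [AddCircle.integral_haarAddCircle, ← UnitAddCircle.intervalIntegral_preimage 0,
    Real.circleAverage_def]
  have h := intervalIntegral.integral_comp_mul_left (a := 0) (b := 1)
    (fun θ => f (circleMap 0 1 θ)) (c := 2 * Real.pi) (by positivity)
  simp only [mul_zero, mul_one] at h
  rw [← h]
  simp only [zero_add, inv_one, one_smul]
  congr 1
  ext x
  congr 1
  rw [fourier_coe_apply]
  simp only [circleMap]
  push_cast
  simp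
  ring_nf

lemma poisson (G : ℂ → ℂ) (hG : DiffContOnCl ℂ G (Metric.ball 0 1)) (z : ℂ) (hz : ‖z‖ < 1) :
    ∫ ζ : UnitAddCircle, ((1 - ‖z‖ ^ 2) / ‖(fourier 1 ζ : ℂ) - z‖ ^ 2) • G (fourier 1 ζ)
      ∂AddCircle.haarAddCircle = G z := by
  have h := hG.circleAverage_poissonKernel_smul' (w := z) (by simpa using hz)
  rw [← integral_circle] at h
  rw [← h]
  congr 1
  ext ζ
  simp only [sub_zero, norm_e, one_pow]

lemma tangent {p t a : ℝ} (hp : 1 ≤ p) (ht : 0 ≤ t) (ha : 0 ≤ a) :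
    a ^ p + p * a ^ (p - 1) * (t - a) ≤ t ^ p := by
  rcases ha.eq_or_lt with rfl | ha
  · rcases hp.eq_or_lt with rfl | hp
    · simp
    · rw [Real.zero_rpow (by linarith), Real.zero_rpow (by linarith)]
      simpa using Real.rpow_nonneg ht p
  · have h := one_add_mul_self_le_rpow_one_add (s := t / a - 1) (by have : 0 ≤ t / a := by positivity
                                                                    linarith) hp
    have h2 : t ^ p = a ^ p * (1 + (t / a - 1)) ^ p := by
      rw [← Real.mul_rpow ha.le (by simp; positivity)]
      congr 1; field_simp; ring
    have h3 : a ^ p = a ^ (p - 1) * a := by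
      rw [← Real.rpow_add_one ha.ne']; simp
    rw [h2]
    refine le_trans (le_of_eq ?_) (mul_le_mul_of_nonneg_left h (Real.rpow_nonneg ha.le p))
    rw [h3]; field_simp

lemma norm_e_sub (ζ : UnitAddCircle) (z : ℂ) :
    ‖1 - (starRingEnd ℂ) z * fourier 1 ζ‖ = ‖(fourier 1 ζ : ℂ) - z‖ := by
  set e : ℂ := fourier 1 ζ with he
  have h1 : (starRingEnd ℂ) e * e = 1 := by
    rw [← Complex.normSq_eq_conj_mul_self, Complex.normSq_eq_norm_sq, he, norm_e]; simp
  have : 1 - (starRingEnd ℂ) z * e = (starRingEnd ℂ) (e - z) * e := by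
    rw [map_sub, sub_mul, h1]
  rw [this, norm_mul, he, norm_e, mul_one, RCLike.norm_conj]

lemma cont_e : Continuous (fun ζ : UnitAddCircle => (fourier 1 ζ : ℂ)) := (fourier 1).continuous

lemma one_dim {p : ℝ} (hp : 1 ≤ p) {R : ℝ} (hR : 1 < R) (g : ℂ → ℂ)
    (hg : DifferentiableOn ℂ g (Metric.ball 0 R)) (z : ℂ) (hz : ‖z‖ < 1) :
    ‖g z‖ ^ p * (1 - ‖z‖ ^ 2) ≤
      ∫ ζ : UnitAddCircle, ‖g (fourier 1 ζ)‖ ^ p ∂AddCircle.haarAddCircle := by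
  have hp0 : 0 < p := by linarith
  have hz2 : 0 < 1 - ‖z‖ ^ 2 := by nlinarith [norm_nonneg z]
  set G : ℂ → ℂ := fun w => g w * (1 - (starRingEnd ℂ) z * w) ^ ((2 / p : ℝ) : ℂ) with hGdef
  have hslit : ∀ w : ℂ, ‖w‖ ≤ 1 → 1 - (starRingEnd ℂ) z * w ∈ Complex.slitPlane := by
    intro w hw
    left
    have h1 : ‖(starRingEnd ℂ) z * w‖ < 1 := by
      rw [norm_mul, RCLike.norm_conj]; nlinarith [norm_nonneg z, norm_nonneg w]
    have := Complex.re_le_norm ((starRingEnd ℂ) z * w)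
    rw [Complex.sub_re, Complex.one_re]; linarith
  have hG : DiffContOnCl ℂ G (Metric.ball 0 1) := by
    apply DifferentiableOn.diffContOnCl
    rw [closure_ball _ one_ne_zero]
    apply DifferentiableOn.mul
    · exact hg.mono (Metric.closedBall_subset_ball hR)
    · apply DifferentiableOn.cpow_const
      · fun_prop
      · intro w hw
        exact hslit w (by simpa using hw)
  have hcl : ∀ ζ : UnitAddCircle, (fourier 1 ζ : ℂ) ∈ Metric.ball (0:ℂ) R := by
    intro ζ; simp only [Metric.mem_ball, dist_zero_right, norm_e]; exact hR
  have hgc : Continuous fun ζ : UnitAddCircle => g (fourier 1 ζ) :=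
    hg.continuousOn.comp_continuous cont_e hcl
  have hGc : Continuous fun ζ : UnitAddCircle => G (fourier 1 ζ) := by
    apply hG.continuousOn.comp_continuous cont_e
    intro ζ
    rw [closure_ball _ one_ne_zero, Metric.mem_closedBall, dist_zero_right, norm_e]
  have hne : ∀ ζ : UnitAddCircle, 0 < ‖(fourier 1 ζ : ℂ) - z‖ := by
    intro ζ
    rw [norm_pos_iff, sub_ne_zero]
    intro h
    rw [← h, norm_e] at hz
    exact lt_irrefl _ hz
  set K : UnitAddCircle → ℝ := fun ζ => (1 - ‖z‖ ^ 2) / ‖(fourier 1 ζ : ℂ) - z‖ ^ 2 with hK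
  have hKc : Continuous K := by
    apply Continuous.div continuous_const
    · exact ((cont_e.sub continuous_const).norm.pow 2)
    · intro ζ; exact (pow_pos (hne ζ) 2).ne'
  have hK0 : ∀ ζ, 0 ≤ K ζ := fun ζ => div_nonneg hz2.le (by positivity)
  have hint : ∀ h : UnitAddCircle → ℝ, Continuous h → Integrable h AddCircle.haarAddCircle :=
    fun h hh => hh.integrable_of_hasCompactSupport (HasCompactSupport.of_compactSpace h)
  have hK1 : ∫ ζ, K ζ ∂AddCircle.haarAddCircle = 1 := by
    have h := poisson (fun _ => 1) diffContOnCl_const z hz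
    have h2 : ∫ ζ, ((K ζ : ℝ) : ℂ) ∂(AddCircle.haarAddCircle (T := 1)) = 1 := by
      rw [← h]; simp [hK]
    rw [integral_complex_ofReal] at h2
    exact_mod_cast h2
  have hKG : ‖G z‖ ≤ ∫ ζ, K ζ * ‖G (fourier 1 ζ)‖ ∂AddCircle.haarAddCircle := by
    rw [← poisson G hG z hz]
    refine (norm_integral_le_integral_norm _).trans (le_of_eq ?_)
    congr 1
    ext ζ
    rw [norm_smul, Real.norm_of_nonneg (hK0 ζ)]
  have hnG : ∀ w, ‖G w‖ ^ p = ‖g w‖ ^ p * ‖1 - (starRingEnd ℂ) z * w‖ ^ 2 := by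
    intro w
    simp only [hGdef]
    rw [norm_mul, Complex.norm_cpow_real, Real.mul_rpow (norm_nonneg _) (by positivity),
      ← Real.rpow_mul (norm_nonneg _), div_mul_cancel₀ _ hp0.ne']
    norm_cast
  set a := ‖G z‖ with ha
  have key : a ^ p ≤ ∫ ζ, K ζ * ‖G (fourier 1 ζ)‖ ^ p ∂AddCircle.haarAddCircle := by
    have hmono : ∫ ζ, ((a ^ p - p * a ^ (p - 1) * a) * K ζ
          + p * a ^ (p - 1) * (K ζ * ‖G (fourier 1 ζ)‖)) ∂AddCircle.haarAddCircle ≤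
        ∫ ζ, K ζ * ‖G (fourier 1 ζ)‖ ^ p ∂AddCircle.haarAddCircle := by
      apply integral_mono
      · exact hint _ ((continuous_const.mul hKc).add (continuous_const.mul (hKc.mul hGc.norm)))
      · apply hint
        exact hKc.mul (hGc.norm.rpow_const fun _ => Or.inr hp0.le)
      · intro ζ
        have := mul_le_mul_of_nonneg_left
          (tangent hp (norm_nonneg (G (fourier 1 ζ))) (norm_nonneg (G z))) (hK0 ζ)
        simp only
        refine le_trans (le_of_eq ?_) this
        rw [← ha]; ring
    have hi1 : Integrable (fun ζ => (a ^ p - p * a ^ (p - 1) * a) * K ζ)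
        AddCircle.haarAddCircle := hint _ (continuous_const.mul hKc)
    have hi2 : Integrable (fun ζ : UnitAddCircle => p * a ^ (p - 1) * (K ζ * ‖G (fourier 1 ζ)‖))
        AddCircle.haarAddCircle := hint _ (continuous_const.mul (hKc.mul hGc.norm))
    rw [integral_add hi1 hi2, integral_const_mul,
      integral_const_mul, hK1] at hmono
    have h0 : 0 ≤ p * a ^ (p - 1) := by positivity
    nlinarith [mul_le_mul_of_nonneg_left hKG h0]
  have h1 : ∀ ζ : UnitAddCircle, K ζ * ‖G (fourier 1 ζ)‖ ^ p
      = (1 - ‖z‖ ^ 2) * ‖g (fourier 1 ζ)‖ ^ p := by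
    intro ζ
    have := (hne ζ).ne'
    rw [hnG, norm_e_sub]
    simp only [hK]
    field_simp
  simp_rw [h1] at key
  rw [integral_const_mul, ha, hnG] at key
  have h2 : ‖1 - (starRingEnd ℂ) z * z‖ = 1 - ‖z‖ ^ 2 := by
    rw [← Complex.normSq_eq_conj_mul_self, Complex.normSq_eq_norm_sq]
    rw [← Complex.ofReal_one, ← Complex.ofReal_sub, Complex.norm_real, Real.norm_of_nonneg hz2.le]
  rw [h2] at key
  refine le_of_mul_le_mul_left ?_ hz2
  nlinarith [key]

lemma multi {p : ℝ} (hp : 1 ≤ p) {R : ℝ} (hR : 1 < R) (m : ℕ) : ∀ (g : (Fin m → ℂ) → ℂ)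
    (_ : DifferentiableOn ℂ g {w | ∀ i, ‖w i‖ < R}) (z : Fin m → ℂ) (_ : ∀ i, ‖z i‖ < 1),
    ‖g z‖ ^ p * ∏ i, (1 - ‖z i‖ ^ 2) ≤
      ∫ ζ : Fin m → UnitAddCircle, ‖g (fun n => fourier 1 (ζ n))‖ ^ p
        ∂(Measure.pi fun _ : Fin m => AddCircle.haarAddCircle) := by
  have hp0 : 0 < p := by linarith
  induction m with
  | zero =>
    intro g hg z hz
    have : ∀ ζ : Fin 0 → UnitAddCircle, (fun n => (fourier 1 (ζ n) : ℂ)) = z :=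
      fun ζ => Subsingleton.elim _ _
    simp only [this]
    simp
  | succ m ih =>
    intro g hg z hz
    have hgc : Continuous fun ζ : UnitAddCircle × (Fin m → UnitAddCircle) =>
        ‖g (Fin.cons (fourier 1 ζ.1 : ℂ) (fun n => (fourier 1 (ζ.2 n) : ℂ)))‖ ^ p := by
      refine Continuous.rpow_const ?_ fun _ => Or.inr hp0.le
      refine Continuous.norm ?_
      refine hg.continuousOn.comp_continuous ?_ ?_
      · refine continuous_pi fun i => ?_
        refine Fin.cases ?_ (fun j => ?_) i
        · simp only [Fin.cons_zero]; exact cont_e.comp continuous_fst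
        · simp only [Fin.cons_succ]; exact cont_e.comp ((continuous_apply j).comp continuous_snd)
      · intro ζ i
        refine Fin.cases ?_ (fun j => ?_) i
        · simpa only [Fin.cons_zero, norm_e] using hR
        · simpa only [Fin.cons_succ, norm_e] using hR
    have hint : Integrable (fun ζ : UnitAddCircle × (Fin m → UnitAddCircle) =>
        ‖g (Fin.cons (fourier 1 ζ.1 : ℂ) (fun n => (fourier 1 (ζ.2 n) : ℂ)))‖ ^ p)
        ((AddCircle.haarAddCircle).prod (Measure.pi fun _ : Fin m => AddCircle.haarAddCircle)) :=
      hgc.integrable_of_hasCompactSupport (HasCompactSupport.of_compactSpace _)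
    have hmp := (measurePreserving_piFinSuccAbove
      (fun _ : Fin (m + 1) => (AddCircle.haarAddCircle : Measure UnitAddCircle)) 0).symm
    rw [← hmp.integral_comp']
    have heq : ∀ ζ : UnitAddCircle × (Fin m → UnitAddCircle),
        (fun n => (fourier 1 ((MeasurableEquiv.piFinSuccAbove (fun _ => UnitAddCircle) 0).symm ζ n) : ℂ))
        = Fin.cons (fourier 1 ζ.1 : ℂ) (fun n => (fourier 1 (ζ.2 n) : ℂ)) := by
      intro ζ
      ext i
      refine Fin.cases ?_ (fun j => ?_) i
      · simp [MeasurableEquiv.piFinSuccAbove, Fin.insertNthEquiv]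
      · simp [MeasurableEquiv.piFinSuccAbove, Fin.insertNthEquiv]
    simp only [heq]
    rw [integral_prod _ hint]
    have hz' : ∀ j, ‖Fin.tail z j‖ < 1 := fun j => hz j.succ
    have hP : 0 ≤ ∏ j, (1 - ‖Fin.tail z j‖ ^ 2) := Finset.prod_nonneg fun j _ => by
      nlinarith [norm_nonneg (Fin.tail z j), hz' j]
    have hd0 : DifferentiableOn ℂ (fun w : ℂ => g (Fin.cons w (Fin.tail z))) (Metric.ball 0 R) := by
      refine hg.comp (t := {w | ∀ i, ‖w i‖ < R}) (f := fun w : ℂ => Fin.cons w (Fin.tail z)) ?_ ?_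
      · rw [differentiableOn_pi]
        intro i
        refine Fin.cases ?_ (fun j => ?_) i
        · simp only [Fin.cons_zero]; exact differentiableOn_id
        · simp
      · intro w hw i
        refine Fin.cases ?_ (fun j => ?_) i
        · simpa using hw
        · simpa using (hz' j).trans hR
    have h1 := one_dim hp hR _ hd0 (z 0) (hz 0)
    simp only [Fin.cons_self_tail] at h1
    rw [Fin.prod_univ_succ, ← mul_assoc]
    refine (mul_le_mul_of_nonneg_right h1 hP).trans ?_
    rw [← integral_mul_const]
    apply integral_mono_of_nonneg
    · exact Filter.Eventually.of_forall fun ζ => mul_nonneg (by positivity) hP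
    · exact hint.integral_prod_left
    · refine Filter.Eventually.of_forall fun ζ => ?_
      refine ih (fun w => g (Fin.cons (fourier 1 ζ : ℂ) w)) ?_ (Fin.tail z) hz'
      refine hg.comp (t := {w | ∀ i, ‖w i‖ < R})
        (f := fun w : Fin m → ℂ => (Fin.cons (fourier 1 ζ : ℂ) w : Fin (m + 1) → ℂ)) ?_ ?_
      · rw [differentiableOn_pi]
        intro i
        refine Fin.cases ?_ (fun j => ?_) i
        · simp
        · simp only [Fin.cons_succ]; fun_prop
      · intro w hw i
        refine Fin.cases ?_ (fun j => ?_) i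
        · simpa only [Fin.cons_zero, norm_e] using hR
        · simpa using hw j

end CG

theorem coleGamelin_pointwise_estimate (m : ℕ) (p : ℝ) (hp : 1 ≤ p)
    (f : (Fin m → ℂ) → ℂ)
    (hf : DifferentiableOn ℂ f {z : Fin m → ℂ | ∀ i, ‖z i‖ < 1}) (M : ℝ)
    (hM : ∀ r : ℝ, 0 < r → r < 1 →
      (∫ z : Fin m → UnitAddCircle, ‖f (fun n => (r : ℂ) * fourier 1 (z n))‖ ^ p
          ∂(Measure.pi fun _ : Fin m => AddCircle.haarAddCircle)) ^ (1 / p) ≤ M) :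
    ∀ z : Fin m → ℂ, (∀ i, ‖z i‖ < 1) →
      ‖f z‖ ≤ M * ∏ i, (1 - ‖z i‖ ^ 2) ^ (-(1 / p)) := by
  intro z hz
  have hp0 : 0 < p := by linarith
  have hpos : ∀ i, 0 < 1 - ‖z i‖ ^ 2 := fun i => by nlinarith [norm_nonneg (z i), hz i]
  have hP : 0 < ∏ i, (1 - ‖z i‖ ^ 2) := Finset.prod_pos fun i _ => hpos i
  have main : ∀ r : ℝ, 0 < r → r < 1 →
      ‖f (fun n => (r : ℂ) * z n)‖ ≤ M * ∏ i, (1 - ‖z i‖ ^ 2) ^ (-(1 / p)) := by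
    intro r hr0 hr1
    have hd : DifferentiableOn ℂ (fun w : Fin m → ℂ => f (fun n => (r : ℂ) * w n))
        {w | ∀ i, ‖w i‖ < 1 / r} := by
      refine hf.comp (t := {z : Fin m → ℂ | ∀ i, ‖z i‖ < 1})
        (f := fun w : Fin m → ℂ => fun n => (r : ℂ) * w n) ?_ ?_
      · fun_prop
      · intro w hw i
        have := hw i
        rw [lt_div_iff₀ hr0] at this
        simp only [norm_mul, Complex.norm_real, Real.norm_of_nonneg hr0.le]
        linarith
    have h := CG.multi hp (R := 1 / r) (by rw [lt_div_iff₀ hr0]; linarith) m _ hd z hz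
    have h2 := (Real.rpow_le_rpow (by positivity) h (by positivity : 0 ≤ 1 / p)).trans (hM r hr0 hr1)
    rw [Real.mul_rpow (by positivity) hP.le, ← Real.rpow_mul (norm_nonneg _),
      mul_one_div_cancel hp0.ne', Real.rpow_one] at h2
    rw [Real.finsetProd_rpow _ _ (fun i _ => (hpos i).le), Real.rpow_neg hP.le, ← div_eq_mul_inv,
      le_div_iff₀ (by positivity)]
    exact h2
  have hopen : IsOpen {z : Fin m → ℂ | ∀ i, ‖z i‖ < 1} := by
    simp only [Set.ofPred_forall]
    exact isOpen_iInter_of_finite fun i => isOpen_lt (by fun_prop) continuous_const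
  have hfc : ContinuousAt f z := (hf.differentiableAt (hopen.mem_nhds hz)).continuousAt
  have hlim : Filter.Tendsto (fun r : ℝ => ‖f (fun n => (r : ℂ) * z n)‖)
      (nhdsWithin 1 (Set.Iio 1)) (nhds ‖f z‖) := by
    refine Filter.Tendsto.norm (Filter.Tendsto.comp hfc ?_)
    have hc : Continuous fun r : ℝ => (fun n => (r : ℂ) * z n) := by fun_prop
    have := hc.tendsto 1
    simp only [Complex.ofReal_one, one_mul] at this
    exact this.mono_left nhdsWithin_le_nhds
  refine le_of_tendsto hlim ?_
  filter_upwards [Ioo_mem_nhdsLT (zero_lt_one (α := ℝ))] with r hr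
  exact main r hr.1 hr.2
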